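/- arXiv:1605.04184 — 2 statements merged into one kernel-verified Lean document; each statement's English description precedes it below -/
import Mathlib

section
/- Let P and Q be mutually absolutely continuous probability measures on a measurable space and let f be a bounded measurable real-valued function. Then |E_Q(f) − E_P(f)| ≤ 2‖f‖_∞ · H(Q,P) · √(1 − H²(Q,P)/4), where H(Q,P) is the Hellinger distance between Q and P. (Le Cam-type inequality for quantities of interest.) -/
open MeasureTheory

/-- Hellinger distance `H(Q,P) = (∫ (1 − √(dP/dQ))² dQ)^{1/2}`. -/
noncomputable def hellingerDist {Ω : Type*} [MeasurableSpace Ω] (Q P : Measure Ω) : ℝ :=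
  Real.sqrt (∫ x, (1 - Real.sqrt ((P.rnDeriv Q x).toReal)) ^ 2 ∂Q)

/-- The root density `√(dP/dQ)` of a finite measure `P` is square integrable. -/
theorem memLp_sqrt_rnDeriv {Ω : Type*} [MeasurableSpace Ω] (P Q : Measure Ω)
    [IsFiniteMeasure P] :
    MemLp (fun x => Real.sqrt ((P.rnDeriv Q x).toReal)) 2 Q := by
  refine (memLp_two_iff_integrable_sq
    (P.measurable_rnDeriv Q).ennreal_toReal.sqrt.aestronglyMeasurable).2 ?_
  simpa only [Real.sq_sqrt ENNReal.toReal_nonneg] using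
    (Measure.integrable_toReal_rnDeriv (μ := P) (ν := Q))

/-- Cauchy–Schwarz inequality for nonnegative real functions. -/
theorem integral_mul_le_sqrt_mul_sqrt {Ω : Type*} [MeasurableSpace Ω] {μ : Measure Ω}
    {u v : Ω → ℝ} (hu0 : 0 ≤ u) (hv0 : 0 ≤ v) (hu : MemLp u 2 μ) (hv : MemLp v 2 μ) :
    ∫ x, u x * v x ∂μ ≤ Real.sqrt (∫ x, u x ^ 2 ∂μ) * Real.sqrt (∫ x, v x ^ 2 ∂μ) := by
  have h := integral_mul_le_Lp_mul_Lq_of_nonneg (μ := μ) Real.HolderConjugate.two_two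
    (Filter.Eventually.of_forall hu0) (Filter.Eventually.of_forall hv0)
    (by simpa using hu) (by simpa using hv)
  simpa only [Real.rpow_two, ← Real.sqrt_eq_rpow] using h

theorem hellingerDist_sq {Ω : Type*} [MeasurableSpace Ω] (Q P : Measure Ω) :
    hellingerDist Q P ^ 2 = ∫ x, (1 - Real.sqrt ((P.rnDeriv Q x).toReal)) ^ 2 ∂Q :=
  Real.sq_sqrt (integral_nonneg fun _ => sq_nonneg _)

theorem integral_one_add_sqrt_rnDeriv_sq {Ω : Type*} [MeasurableSpace Ω] (P Q : Measure Ω)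
    [IsProbabilityMeasure P] [IsProbabilityMeasure Q] (hPQ : P ≪ Q) :
    ∫ x, (1 + Real.sqrt ((P.rnDeriv Q x).toReal)) ^ 2 ∂Q = 4 - hellingerDist Q P ^ 2 := by
  have hs := memLp_sqrt_rnDeriv P Q
  have h1 : MemLp (fun _ : Ω => (1 : ℝ)) 2 Q := memLp_const 1
  have hg : ∫ x, (P.rnDeriv Q x).toReal ∂Q = 1 := by
    simp [Measure.integral_toReal_rnDeriv hPQ]
  have hadd : Integrable (fun x => (1 + Real.sqrt ((P.rnDeriv Q x).toReal)) ^ 2) Q :=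
    (h1.add hs).integrable_sq
  have hsub : Integrable (fun x => (1 - Real.sqrt ((P.rnDeriv Q x).toReal)) ^ 2) Q :=
    (h1.sub hs).integrable_sq
  rw [hellingerDist_sq, eq_sub_iff_add_eq, ← integral_add hadd hsub]
  calc _ = ∫ x, (2 + 2 * (P.rnDeriv Q x).toReal) ∂Q := by
        refine integral_congr_ae (Filter.Eventually.of_forall fun x => ?_)
        have := Real.sq_sqrt (ENNReal.toReal_nonneg (a := P.rnDeriv Q x))
        dsimp only
        linear_combination 2 * this
    _ = 4 := by
        rw [integral_add (integrable_const 2) (Measure.integrable_toReal_rnDeriv.const_mul 2),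
          integral_const_mul, hg]
        norm_num

/-- Le Cam's bound of the total variation by the Hellinger distance. -/
theorem integral_abs_one_sub_rnDeriv_le {Ω : Type*} [MeasurableSpace Ω] (P Q : Measure Ω)
    [IsProbabilityMeasure P] [IsProbabilityMeasure Q] (hPQ : P ≪ Q) :
    ∫ x, |1 - (P.rnDeriv Q x).toReal| ∂Q ≤
      2 * hellingerDist Q P * Real.sqrt (1 - hellingerDist Q P ^ 2 / 4) := by
  have hs := memLp_sqrt_rnDeriv P Q
  have h1 : MemLp (fun _ : Ω => (1 : ℝ)) 2 Q := memLp_const 1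
  have hfactor (x : Ω) : |1 - (P.rnDeriv Q x).toReal| =
      |1 - Real.sqrt ((P.rnDeriv Q x).toReal)| * (1 + Real.sqrt ((P.rnDeriv Q x).toReal)) := by
    have hpos : 0 ≤ 1 + Real.sqrt ((P.rnDeriv Q x).toReal) := by positivity
    conv_rhs => rw [← abs_of_nonneg hpos, ← abs_mul]
    congr 1
    linear_combination Real.sq_sqrt (ENNReal.toReal_nonneg (a := P.rnDeriv Q x))
  have hsqrt : Real.sqrt (4 - hellingerDist Q P ^ 2) =
      2 * Real.sqrt (1 - hellingerDist Q P ^ 2 / 4) := by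
    rw [show 4 - hellingerDist Q P ^ 2 = 2 ^ 2 * (1 - hellingerDist Q P ^ 2 / 4) by ring,
      Real.sqrt_mul (by norm_num), Real.sqrt_sq (by norm_num)]
  have hcs := integral_mul_le_sqrt_mul_sqrt (μ := Q)
    (u := fun x => |1 - Real.sqrt ((P.rnDeriv Q x).toReal)|)
    (v := fun x => 1 + Real.sqrt ((P.rnDeriv Q x).toReal))
    (fun x => abs_nonneg _) (fun x => by simp only [Pi.zero_apply]; positivity)
    (h1.sub hs).abs (h1.add hs)
  simp only [sq_abs, integral_one_add_sqrt_rnDeriv_sq P Q hPQ, hsqrt, ← hfactor] at hcs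
  exact hcs.trans_eq (by rw [← hellingerDist]; ring)

/-- Le Cam-type inequality for quantities of interest. -/
theorem stmt_4 {Ω : Type*} [MeasurableSpace Ω] (P Q : Measure Ω)
    [IsProbabilityMeasure P] [IsProbabilityMeasure Q]
    (hQP : Q ≪ P) (hPQ : P ≪ Q)
    (f : Ω → ℝ) (hf : Measurable f) (C : ℝ) (hbdd : ∀ x, |f x| ≤ C) :
    |(∫ x, f x ∂Q) - ∫ x, f x ∂P| ≤
      2 * essSup (fun x => |f x|) P * hellingerDist Q P *
        Real.sqrt (1 - hellingerDist Q P ^ 2 / 4) := by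
  have hbound : Filter.IsBoundedUnder (· ≤ ·) (ae P) fun x => |f x| :=
    Filter.isBoundedUnder_of ⟨C, hbdd⟩
  have hM : ∀ᵐ x ∂P, |f x| ≤ essSup (fun x => |f x|) P := ae_le_essSup hbound
  have hM0 : 0 ≤ essSup (fun x => |f x|) P := by
    obtain ⟨x, hx⟩ := hM.exists
    exact (abs_nonneg _).trans hx
  have hfi (μ : Measure Ω) [IsProbabilityMeasure μ] : Integrable f μ :=
    Integrable.of_bound hf.aestronglyMeasurable C (Filter.Eventually.of_forall hbdd)
  have hgf : Integrable (fun x => (P.rnDeriv Q x).toReal • f x) Q :=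
    (integrable_rnDeriv_smul_iff hPQ).2 (hfi P)
  have hg : Integrable (fun x => 1 - (P.rnDeriv Q x).toReal) Q :=
    (integrable_const 1).sub Measure.integrable_toReal_rnDeriv
  rw [← integral_rnDeriv_smul hPQ, ← integral_sub (hfi Q) hgf]
  calc _ ≤ ∫ x, |f x - (P.rnDeriv Q x).toReal • f x| ∂Q := abs_integral_le_integral_abs
    _ ≤ ∫ x, essSup (fun x => |f x|) P * |1 - (P.rnDeriv Q x).toReal| ∂Q := by
        refine integral_mono_ae ((hfi Q).sub hgf).abs (hg.abs.const_mul _) ?_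
        filter_upwards [hQP.ae_le hM] with x hx
        rw [smul_eq_mul, ← one_sub_mul, abs_mul, mul_comm]
        gcongr
    _ ≤ essSup (fun x => |f x|) P *
        (2 * hellingerDist Q P * Real.sqrt (1 - hellingerDist Q P ^ 2 / 4)) := by
        rw [integral_const_mul]
        gcongr
        exact integral_abs_one_sub_rnDeriv_le P Q hPQ
    _ = _ := by ring
end

section
/- Let p and q be transition matrices of two irreducible Markov chains on a finite state space S, with p(x,·) and q(x,·) mutually absolutely continuous for each x, and with mutually absolutely continuous initial distributions; let P_N, Q_N denote the path laws. Then lim_{N→∞} (1/N) log(1 + χ²(Q_N‖P_N)) = log ρ(2), where ρ(2) is the maximal (Perron–Frobenius) eigenvalue of the nonnegative matrix with entries q(x,y)² / p(x,y); moreover log ρ(2) ≥ 0 with equality if and only if p = q. -/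
open Finset Filter

/-- Law of the length-`N` path of a Markov chain with transition matrix `p`
and initial distribution `ν`. -/
noncomputable def pathLaw {S : Type*} [Fintype S] (p : Matrix S S ℝ) (ν : S → ℝ)
    (N : ℕ) (ω : Fin (N + 1) → S) : ℝ :=
  ν (ω 0) * ∏ k : Fin N, p (ω k.castSucc) (ω k.succ)

/-- Pairing the path law of a kernel with one of its eigenfunctions at the final time. -/
theorem sum_pathLaw_mul_eigenfunction {S : Type*} [Fintype S] (A : Matrix S S ℝ) (u v : S → ℝ)
    (ρ : ℝ) (h : ∀ x, ∑ y, A x y * v y = ρ * v x) (N : ℕ) :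
    ∑ ω : Fin (N + 1) → S, pathLaw A u N ω * v (ω (Fin.last N)) = ρ ^ N * ∑ x, u x * v x := by
  induction N with
  | zero =>
    rw [← (Equiv.funUnique (Fin 1) S).symm.sum_comp]
    simp [pathLaw, Equiv.funUnique]
  | succ N ih =>
    rw [← (Fin.snocEquiv fun _ : Fin (N + 2) => S).sum_comp, Fintype.sum_prod_type_right,
      pow_succ', mul_assoc, ← ih, Finset.mul_sum]
    refine Finset.sum_congr rfl fun ω _ => ?_
    have hstep (y : S) : pathLaw A u (N + 1) (Fin.snoc (α := fun _ => S) ω y) =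
        pathLaw A u N ω * A (ω (Fin.last N)) y := by
      have h0 : Fin.snoc (α := fun _ => S) ω y 0 = ω 0 :=
        Fin.snoc_castSucc (α := fun _ => S) y ω 0
      simp only [pathLaw, Fin.prod_univ_castSucc (n := N), h0, ← Fin.castSucc_succ, Fin.succ_last,
        Fin.snoc_castSucc, Fin.snoc_last, mul_assoc]
    simp only [Fin.snocEquiv, Equiv.coe_fn_mk, hstep, Fin.snoc_last, mul_assoc]
    rw [← Finset.mul_sum, h]
    ring

theorem sum_pathLaw_eq_one {S : Type*} [Fintype S] (p : Matrix S S ℝ) (ν : S → ℝ)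
    (hp : ∀ x, ∑ y, p x y = 1) (hν : ∑ x, ν x = 1) (N : ℕ) :
    ∑ ω : Fin (N + 1) → S, pathLaw p ν N ω = 1 := by
  simpa [hν] using sum_pathLaw_mul_eigenfunction p ν 1 1 (by simpa using hp) N

theorem pathLaw_nonneg {S : Type*} [Fintype S] (p : Matrix S S ℝ) (ν : S → ℝ)
    (hp : ∀ x y, 0 ≤ p x y) (hν : ∀ x, 0 ≤ ν x) (N : ℕ) (ω : Fin (N + 1) → S) :
    0 ≤ pathLaw p ν N ω :=
  mul_nonneg (hν _) (Finset.prod_nonneg fun _ _ => hp _ _)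

theorem pathLaw_eq_zero_of_ac {S : Type*} [Fintype S] (p q : Matrix S S ℝ) (νp νq : S → ℝ)
    (hrows : ∀ x y, p x y = 0 → q x y = 0) (hν : ∀ x, νp x = 0 → νq x = 0) (N : ℕ)
    (ω : Fin (N + 1) → S) (h : pathLaw p νp N ω = 0) : pathLaw q νq N ω = 0 := by
  rcases mul_eq_zero.1 h with h | h
  · simp [pathLaw, hν _ h]
  · obtain ⟨k, hk, hk0⟩ := Finset.prod_eq_zero_iff.1 h
    exact mul_eq_zero_of_right _ (Finset.prod_eq_zero hk (hrows _ _ hk0))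

theorem pathLaw_sq_div {S : Type*} [Fintype S] (p q : Matrix S S ℝ) (νp νq : S → ℝ) (N : ℕ)
    (ω : Fin (N + 1) → S) :
    pathLaw q νq N ω ^ 2 / pathLaw p νp N ω =
      pathLaw (Matrix.of fun x y => q x y ^ 2 / p x y) (fun x => νq x ^ 2 / νp x) N ω := by
  simp only [pathLaw, Matrix.of_apply, Finset.prod_div_distrib, Finset.prod_pow, mul_pow,
    mul_div_mul_comm]

/-- One plus the chi-squared divergence is the second moment of the density. -/
theorem one_add_chiSq_eq {ι : Type*} [Fintype ι] (f g : ι → ℝ) (hac : ∀ i, g i = 0 → f i = 0)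
    (hf : ∑ i, f i = 1) (hg : ∑ i, g i = 1) :
    1 + ∑ i, (f i / g i - 1) ^ 2 * g i = ∑ i, f i ^ 2 / g i := by
  have h (i : ι) : (f i / g i - 1) ^ 2 * g i = f i ^ 2 / g i - 2 * f i + g i := by
    by_cases hi : g i = 0
    · simp [hi, hac i hi]
    · field_simp
      ring
  simp only [h, Finset.sum_add_distrib, Finset.sum_sub_distrib, ← Finset.mul_sum, hf, hg]
  ring

theorem one_le_sum_sq_div {ι : Type*} [Fintype ι] (f g : ι → ℝ) (hac : ∀ i, g i = 0 → f i = 0)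
    (hf : ∑ i, f i = 1) (hg : ∑ i, g i = 1) (hg0 : ∀ i, 0 ≤ g i) : 1 ≤ ∑ i, f i ^ 2 / g i := by
  rw [← one_add_chiSq_eq f g hac hf hg, le_add_iff_nonneg_right]
  exact Finset.sum_nonneg fun i _ => mul_nonneg (sq_nonneg _) (hg0 i)

theorem eq_of_sum_sq_div_le_one {ι : Type*} [Fintype ι] (f g : ι → ℝ)
    (hac : ∀ i, g i = 0 → f i = 0) (hf : ∑ i, f i = 1) (hg : ∑ i, g i = 1) (hg0 : ∀ i, 0 ≤ g i)
    (h : ∑ i, f i ^ 2 / g i ≤ 1) : g = f := by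
  have hnn (i : ι) (_ : i ∈ Finset.univ) : 0 ≤ (f i / g i - 1) ^ 2 * g i :=
    mul_nonneg (sq_nonneg _) (hg0 i)
  have h0 : ∑ i, (f i / g i - 1) ^ 2 * g i = 0 :=
    le_antisymm (by linarith [one_add_chiSq_eq f g hac hf hg]) (Finset.sum_nonneg hnn)
  funext i
  by_cases hi : g i = 0
  · rw [hi, hac i hi]
  · have := (Finset.sum_eq_zero_iff_of_nonneg hnn).1 h0 i (Finset.mem_univ i)
    have := (mul_eq_zero.1 this).resolve_right hi
    exact ((div_eq_one_iff_eq hi).1 (sub_eq_zero.1 (pow_eq_zero_iff two_ne_zero |>.1 this))).symm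

/-- A property preserved along nonzero entries of a matrix is preserved along
nonzero entries of its powers. -/
theorem Matrix.of_pow_apply_ne_zero {S : Type*} [Fintype S] [DecidableEq S] (q : Matrix S S ℝ)
    (T : S → Prop) (hT : ∀ x y, T x → q x y ≠ 0 → T y) (n : ℕ) :
    ∀ x y, T x → (q ^ n) x y ≠ 0 → T y := by
  induction n with
  | zero =>
    intro x y hx h
    obtain rfl : x = y := by
      by_contra hxy
      simp [Matrix.one_apply_ne hxy] at h
    exact hx
  | succ n ih =>
    intro x y hx h
    rw [pow_succ, Matrix.mul_apply] at h
    obtain ⟨z, -, hz⟩ := Finset.exists_ne_zero_of_sum_ne_zero h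
    exact hT z y (ih x z hx (left_ne_zero_of_mul hz)) (right_ne_zero_of_mul hz)

/-- Exponential growth rate of a sequence comparable with `ρ ^ N`. -/
theorem tendsto_log_div_of_pow_bounds (z : ℕ → ℝ) (ρ a b : ℝ) (hρ : 0 < ρ) (ha : 0 < a)
    (hb : 0 < b) (hlow : ∀ N, a * ρ ^ N ≤ z N) (hupp : ∀ N, z N ≤ b * ρ ^ N) :
    Tendsto (fun N : ℕ => (1 / (N : ℝ)) * Real.log (z N)) atTop (nhds (Real.log ρ)) := by
  have hlim (c : ℝ) : Tendsto (fun N : ℕ => c / (N : ℝ) + Real.log ρ) atTop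
      (nhds (Real.log ρ)) := by
    simpa using (tendsto_const_div_atTop_nhds_zero_nat c).add_const (Real.log ρ)
  have hlog (c : ℝ) (hc : 0 < c) (N : ℕ) (hN : 0 < N) :
      Real.log c / (N : ℝ) + Real.log ρ = (1 / (N : ℝ)) * Real.log (c * ρ ^ N) := by
    rw [Real.log_mul hc.ne' (pow_pos hρ N).ne', Real.log_pow]
    field_simp
  refine tendsto_of_tendsto_of_tendsto_of_le_of_le' (hlim (Real.log a)) (hlim (Real.log b)) ?_ ?_
  · filter_upwards [eventually_gt_atTop 0] with N hN
    rw [hlog a ha N hN]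
    have := mul_pos ha (pow_pos hρ N)
    gcongr
    exact hlow N
  · filter_upwards [eventually_gt_atTop 0] with N hN
    rw [hlog b hb N hN]
    have := (mul_pos ha (pow_pos hρ N)).trans_le (hlow N)
    gcongr
    exact hupp N

/-- `(1/N) log(1 + χ²(Q_N‖P_N))` converges to `log ρ(2)`, where `ρ(2)` is the
Perron–Frobenius eigenvalue (characterized as the eigenvalue with a positive eigenvector)
of the nonnegative matrix with entries `q(x,y)²/p(x,y)`; moreover `log ρ(2) ≥ 0`
with equality if and only if `p = q`. -/
theorem stmt_12 {S : Type*} [Fintype S] [DecidableEq S] [Nonempty S]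
    (p q : Matrix S S ℝ) (νp νq : S → ℝ)
    (hp0 : ∀ x y, 0 ≤ p x y) (hp1 : ∀ x, ∑ y, p x y = 1)
    (hq0 : ∀ x y, 0 ≤ q x y) (hq1 : ∀ x, ∑ y, q x y = 1)
    (hpirr : ∀ x y, ∃ n : ℕ, 0 < (p ^ n) x y)
    (hqirr : ∀ x y, ∃ n : ℕ, 0 < (q ^ n) x y)
    (hrows : ∀ x y, p x y = 0 ↔ q x y = 0)
    (hνp0 : ∀ x, 0 ≤ νp x) (hνp1 : ∑ x, νp x = 1)
    (hνq0 : ∀ x, 0 ≤ νq x) (hνq1 : ∑ x, νq x = 1)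
    (hνac : ∀ x, νp x = 0 ↔ νq x = 0)
    (ρ : ℝ) (v : S → ℝ) (hv : ∀ x, 0 < v x)
    (heig : ∀ x, ∑ y, (q x y ^ 2 / p x y) * v y = ρ * v x) :
    Tendsto (fun N : ℕ =>
        (1 / (N : ℝ)) * Real.log (1 + ∑ ω : Fin (N + 1) → S,
          (pathLaw q νq N ω / pathLaw p νp N ω - 1) ^ 2 * pathLaw p νp N ω))
      atTop (nhds (Real.log ρ))
    ∧ 0 ≤ Real.log ρ
    ∧ (Real.log ρ = 0 ↔ p = q) := by
  have hA0 (x y : S) : 0 ≤ q x y ^ 2 / p x y := div_nonneg (sq_nonneg _) (hp0 x y)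
  have hrow (x : S) : 1 ≤ ∑ y, q x y ^ 2 / p x y :=
    one_le_sum_sq_div (q x) (p x) (fun y => (hrows x y).1) (hq1 x) (hp1 x) (hp0 x)
  obtain ⟨a, ha⟩ := Finite.exists_min v
  obtain ⟨b, hb⟩ := Finite.exists_max v
  have hρ1 : 1 ≤ ρ := by
    have h : v a ≤ ρ * v a := calc
      v a ≤ (∑ y, q a y ^ 2 / p a y) * v a := le_mul_of_one_le_left (hv a).le (hrow a)
      _ = ∑ y, q a y ^ 2 / p a y * v a := Finset.sum_mul _ _ _
      _ ≤ ∑ y, q a y ^ 2 / p a y * v y :=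
        Finset.sum_le_sum fun y _ => mul_le_mul_of_nonneg_left (ha y) (hA0 a y)
      _ = ρ * v a := heig a
    exact (le_mul_iff_one_le_left (hv a)).1 h
  have hρ : 0 < ρ := one_pos.trans_le hρ1
  refine ⟨?_, Real.log_nonneg hρ1, ?_, ?_⟩
  · set A : Matrix S S ℝ := Matrix.of fun x y => q x y ^ 2 / p x y
    set u : S → ℝ := fun x => νq x ^ 2 / νp x
    have hu (x : S) : 0 ≤ u x := div_nonneg (sq_nonneg _) (hνp0 x)
    have hZ (N : ℕ) : 1 + ∑ ω : Fin (N + 1) → S,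
        (pathLaw q νq N ω / pathLaw p νp N ω - 1) ^ 2 * pathLaw p νp N ω =
          ∑ ω : Fin (N + 1) → S, pathLaw A u N ω := by
      rw [one_add_chiSq_eq _ _
        (pathLaw_eq_zero_of_ac p q νp νq (fun x y => (hrows x y).1) (fun x => (hνac x).1) N)
        (sum_pathLaw_eq_one q νq hq1 hνq1 N) (sum_pathLaw_eq_one p νp hp1 hνp1 N)]
      exact Finset.sum_congr rfl fun ω _ => pathLaw_sq_div p q νp νq N ω
    simp only [hZ]
    have hC : 0 < ∑ x, u x * v x := by
      obtain ⟨x, -, hx⟩ := Finset.exists_ne_zero_of_sum_ne_zero (hνq1.trans_ne one_ne_zero)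
      have hpx : 0 < νp x := (hνp0 x).lt_of_ne' (mt (hνac x).1 hx)
      exact Finset.sum_pos' (fun y _ => mul_nonneg (hu y) (hv y).le)
        ⟨x, Finset.mem_univ x, mul_pos (div_pos (by positivity) hpx) (hv x)⟩
    have hAN (N : ℕ) (ω : Fin (N + 1) → S) : 0 ≤ pathLaw A u N ω :=
      pathLaw_nonneg A u hA0 hu N ω
    refine tendsto_log_div_of_pow_bounds _ ρ ((∑ x, u x * v x) / v b) ((∑ x, u x * v x) / v a)
      hρ (div_pos hC (hv b)) (div_pos hC (hv a)) (fun N => ?_) fun N => ?_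
    · rw [div_mul_eq_mul_div, div_le_iff₀ (hv b), mul_comm,
        ← sum_pathLaw_mul_eigenfunction A u v ρ heig N, Finset.sum_mul]
      exact Finset.sum_le_sum fun ω _ => mul_le_mul_of_nonneg_left (hb _) (hAN N ω)
    · rw [div_mul_eq_mul_div, le_div_iff₀ (hv a), mul_comm _ (ρ ^ N),
        ← sum_pathLaw_mul_eigenfunction A u v ρ heig N, Finset.sum_mul]
      exact Finset.sum_le_sum fun ω _ => mul_le_mul_of_nonneg_left (ha _) (hAN N ω)
  · intro hlog
    obtain rfl : ρ = 1 := Real.eq_one_of_pos_of_log_eq_zero hρ hlog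
    have hmin (x : S) (hx : v x = v a) :
        (∑ y, q x y ^ 2 / p x y) * v a + ∑ y, q x y ^ 2 / p x y * (v y - v a) = v a := by
      have := heig x
      simp only [mul_sub, Finset.sum_sub_distrib, Finset.sum_mul]
      linarith
    have hnn (x y : S) : 0 ≤ q x y ^ 2 / p x y * (v y - v a) :=
      mul_nonneg (hA0 x y) (sub_nonneg.2 (ha y))
    have hstep (x y : S) (hx : v x = v a) (hxy : q x y ≠ 0) : v y = v a := by
      have h0 : ∑ y, q x y ^ 2 / p x y * (v y - v a) = 0 :=
        le_antisymm (by nlinarith [hmin x hx, hrow x, hv a]) (Finset.sum_nonneg fun y _ => hnn x y)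
      have h := (Finset.sum_eq_zero_iff_of_nonneg fun y _ => hnn x y).1 h0 y (Finset.mem_univ y)
      have hA : q x y ^ 2 / p x y ≠ 0 :=
        div_ne_zero (pow_ne_zero 2 hxy) (mt (hrows x y).1 hxy)
      exact sub_eq_zero.1 ((mul_eq_zero.1 h).resolve_left hA)
    funext x
    obtain ⟨n, hn⟩ := hqirr a x
    have hx := q.of_pow_apply_ne_zero (fun x => v x = v a) hstep n a x rfl hn.ne'
    refine eq_of_sum_sq_div_le_one (q x) (p x) (fun y => (hrows x y).1) (hq1 x) (hp1 x) (hp0 x) ?_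
    have h := Finset.sum_nonneg fun y (_ : y ∈ Finset.univ) => hnn x y
    exact (mul_le_iff_le_one_left (hv a)).1 (by linarith [hmin x hx])
  · rintro rfl
    have h : ρ * v b ≤ v b := calc
      ρ * v b = ∑ y, p b y * v y := by
        rw [← heig b]
        exact Finset.sum_congr rfl fun y _ => by rw [sq, mul_self_div_self]
      _ ≤ ∑ y, p b y * v b :=
        Finset.sum_le_sum fun y _ => mul_le_mul_of_nonneg_left (hb y) (hp0 b y)
      _ = v b := by rw [← Finset.sum_mul, hp1, one_mul]
    rw [le_antisymm ((mul_le_iff_le_one_left (hv b)).1 h) hρ1, Real.log_one]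
end
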